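/- (Uniform continuity of the Rényi information in the prior.) Let C := sup over probability vectors Q on {1,…,n} of I^{(1)}_1(Q,W) (this supremum is finite). Then for all probability vectors P_1, P_2 on {1,…,n} and all α ∈ (0,1], setting δ := (1/2)·‖P_1−P_2‖₁, one has |I^{(1)}_α(P_2,W) − I^{(1)}_α(P_1,W)| ≤ δ·C + h(δ) + log(1 − δ + δ·e^{C}). -/

import Mathlib

open Matrix
open scoped ComplexOrder

/-- Real power of a (hermitian) matrix via the continuous functional calculus. -/
noncomputable def mpow {ι : Type*} [Fintype ι] [DecidableEq ι]
    (A : Matrix ι ι ℂ) (r : ℝ) : Matrix ι ι ℂ :=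
  cfc (fun x : ℝ => x ^ r) A

/-- Logarithm of a (hermitian) matrix via the continuous functional calculus. -/
noncomputable def mlog {ι : Type*} [Fintype ι] [DecidableEq ι]
    (A : Matrix ι ι ℂ) : Matrix ι ι ℂ :=
  cfc Real.log A

/-- Real part of the trace. -/
noncomputable def trR {ι : Type*} [Fintype ι] (A : Matrix ι ι ℂ) : ℝ :=
  (Matrix.trace A).re

/-- Positive definite density matrices. -/
def Dens (d : ℕ) : Type :=
  {σ : Matrix (Fin d) (Fin d) ℂ // σ.PosDef ∧ σ.trace = 1}

/-- Umegaki relative entropy. -/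
noncomputable def Dumegaki {d : ℕ} (ρ σ : Matrix (Fin d) (Fin d) ℂ) : ℝ :=
  trR (ρ * (mlog ρ - mlog σ))

/-- Petz Rényi information, extended to `α = 1` by the Umegaki relative entropy. -/
noncomputable def renyiInfoFull {d n : ℕ} (α : ℝ) (W : Fin n → Matrix (Fin d) (Fin d) ℂ)
    (P : Fin n → ℝ) : ℝ :=
  if α = 1 then ⨅ σ : Dens d, ∑ i, P i * Dumegaki (W i) σ.1
  else ⨅ σ : Dens d, (1 / (α - 1)) *
    Real.log (∑ i, P i * trR (mpow (W i) α * mpow σ.1 (1 - α)))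

/-- Binary entropy. -/
noncomputable def bent (δ : ℝ) : ℝ := -δ * Real.log δ - (1 - δ) * Real.log (1 - δ)

/-- Simultaneous spectral representation of two density matrices by a doubly stochastic matrix. -/
theorem exists_spectral_coupling {d : ℕ} {ρ σ : Matrix (Fin d) (Fin d) ℂ}
    (hρ : ρ.PosDef ∧ ρ.trace = 1) (hσ : σ.PosDef ∧ σ.trace = 1) :
    ∃ (w : Fin d → Fin d → ℝ) (p q : Fin d → ℝ), (∀ i j, 0 ≤ w i j) ∧
      (∀ i, ∑ j, w i j = 1) ∧ (∀ j, ∑ i, w i j = 1) ∧ (∀ i, 0 < p i) ∧ (∀ j, 0 < q j) ∧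
      ∑ i, p i = 1 ∧ ∑ j, q j = 1 ∧
      ∀ f g : ℝ → ℝ, trR (cfc f ρ * cfc g σ) = ∑ i, ∑ j, w i j * (f (p i) * g (q j)) := by
  obtain ⟨hρ, hρt⟩ := hρ
  obtain ⟨hσ, hσt⟩ := hσ
  set U := hρ.isHermitian.eigenvectorUnitary
  set V := hσ.isHermitian.eigenvectorUnitary
  set M : Matrix (Fin d) (Fin d) ℂ := star (U : Matrix (Fin d) (Fin d) ℂ) * V with hM
  have hstar : star M = star (V : Matrix (Fin d) (Fin d) ℂ) * U := by simp [hM]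
  have hMM : M * star M = 1 := by
    rw [hstar, hM, mul_assoc, ← mul_assoc (V : Matrix (Fin d) (Fin d) ℂ)]
    simp
  have hMM' : star M * M = 1 := mul_eq_one_comm.mp hMM
  refine ⟨fun i j => Complex.normSq (M i j), hρ.isHermitian.eigenvalues,
    hσ.isHermitian.eigenvalues, fun i j => Complex.normSq_nonneg _, fun i => ?_, fun j => ?_,
    hρ.eigenvalues_pos, hσ.eigenvalues_pos, ?_, ?_, fun f g => ?_⟩
  · have := congr_fun (congr_fun hMM i) i
    simp only [Matrix.mul_apply, Matrix.star_apply, Matrix.one_apply_eq, RCLike.star_def,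
      Complex.mul_conj] at this
    exact_mod_cast this
  · have := congr_fun (congr_fun hMM' j) j
    simp only [Matrix.mul_apply, Matrix.star_apply, Matrix.one_apply_eq, RCLike.star_def,
      mul_comm ((starRingEnd ℂ) _), Complex.mul_conj] at this
    exact_mod_cast this
  · have := hρ.isHermitian.trace_eq_sum_eigenvalues
    rw [hρt] at this
    exact Complex.ofReal_injective (by simpa using this.symm)
  · have := hσ.isHermitian.trace_eq_sum_eigenvalues
    rw [hσt] at this
    exact Complex.ofReal_injective (by simpa using this.symm)
  · rw [hρ.isHermitian.cfc_eq, hσ.isHermitian.cfc_eq, Matrix.IsHermitian.cfc,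
      Matrix.IsHermitian.cfc, Unitary.conjStarAlgAut_apply, Unitary.conjStarAlgAut_apply]
    set F := diagonal ((RCLike.ofReal : ℝ → ℂ) ∘ f ∘ hρ.isHermitian.eigenvalues) with hF
    set G := diagonal ((RCLike.ofReal : ℝ → ℂ) ∘ g ∘ hσ.isHermitian.eigenvalues) with hG
    have key : ((U : Matrix (Fin d) (Fin d) ℂ) * F * star (U : Matrix (Fin d) (Fin d) ℂ) *
        (V * G * star (V : Matrix (Fin d) (Fin d) ℂ))).trace = (F * M * (G * star M)).trace := by
      rw [hstar, hM]
      simp only [mul_assoc]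
      rw [Matrix.trace_mul_comm]
      simp only [mul_assoc]
    have entry : (F * M * (G * star M)).trace =
        ((∑ i, ∑ j, Complex.normSq (M i j) *
          (f (hρ.isHermitian.eigenvalues i) * g (hσ.isHermitian.eigenvalues j)) : ℝ) : ℂ) := by
      simp only [Matrix.trace, Matrix.diag_apply]
      push_cast
      refine Finset.sum_congr rfl fun i _ => ?_
      rw [Matrix.mul_apply]
      refine Finset.sum_congr rfl fun j _ => ?_
      rw [hF, hG, Matrix.diagonal_mul, Matrix.diagonal_mul, Matrix.star_apply,
        ← Complex.mul_conj]
      simp only [Function.comp_apply, RCLike.star_def, Complex.coe_algebraMap]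
      ring
    rw [trR]
    exact (congrArg Complex.re (key.trans entry)).trans (Complex.ofReal_re _)

theorem trR_sub {d : ℕ} (A B : Matrix (Fin d) (Fin d) ℂ) : trR (A - B) = trR A - trR B := by
  simp [trR]

theorem trR_smul {d : ℕ} (c : ℝ) (A : Matrix (Fin d) (Fin d) ℂ) :
    trR (c • A) = c * trR A := by
  simp [trR]

section OperatorMonotone

open scoped MatrixOrder Matrix.Norms.L2Operator

theorem trR_mul_nonneg {d : ℕ} {A B : Matrix (Fin d) (Fin d) ℂ} (hA : A.PosSemidef)
    (hB : B.PosSemidef) : 0 ≤ trR (A * B) := by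
  obtain ⟨S, rfl⟩ := CStarAlgebra.nonneg_iff_eq_star_mul_self.mp
    (Matrix.nonneg_iff_posSemidef.mpr hA)
  rw [trR, mul_assoc, Matrix.trace_mul_comm]
  exact (Complex.le_def.mp (hB.mul_mul_conjTranspose_same S).trace_nonneg).1

theorem mpow_posSemidef {d : ℕ} {A : Matrix (Fin d) (Fin d) ℂ} (hA : A.PosDef) (r : ℝ) :
    (mpow A r).PosSemidef := by
  rw [← Matrix.nonneg_iff_posSemidef]
  exact cfc_nonneg fun x hx => Real.rpow_nonneg
    (spectrum_nonneg_of_nonneg (Matrix.nonneg_iff_posSemidef.mpr hA.posSemidef) hx) _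

theorem smul_mpow_le_mpow {d : ℕ} {σ τ : Matrix (Fin d) (Fin d) ℂ} (hτ : τ.PosDef)
    {c s : ℝ} (hc : 0 ≤ c) (hs : s ∈ Set.Icc (0 : ℝ) 1) (h : c • τ ≤ σ) :
    c ^ s • mpow τ s ≤ mpow σ s := by
  have hτ0 : 0 ≤ τ := Matrix.nonneg_iff_posSemidef.mpr hτ.posSemidef
  have hcτ : 0 ≤ c • τ := smul_nonneg hc hτ0
  have key := CFC.rpow_le_rpow hs h
  rw [CFC.rpow_eq_cfc_real hcτ, CFC.rpow_eq_cfc_real (hcτ.trans h)] at key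
  have hscale : c ^ s • mpow τ s = cfc (fun x : ℝ => x ^ s) (c • τ) := by
    have hcont : ContinuousOn (fun x : ℝ => x ^ s) ((fun x : ℝ => c • x) '' spectrum ℝ τ) :=
      (Real.continuous_rpow_const hs.1).continuousOn
    rw [← cfc_smul_id (R := ℝ) c τ, ← cfc_comp (fun x : ℝ => x ^ s) (c • ·) τ, mpow,
      ← cfc_const_mul (c ^ s) (fun x : ℝ => x ^ s) τ
        (Real.continuous_rpow_const hs.1).continuousOn]
    exact cfc_congr fun x hx => (Real.mul_rpow hc (spectrum_nonneg_of_nonneg hτ0 hx)).symm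
  rw [hscale]
  exact key

theorem log_add_mlog_le_mlog {d : ℕ} {σ τ : Matrix (Fin d) (Fin d) ℂ} (hτ : τ.PosDef)
    {c : ℝ} (hc : 0 < c) (h : c • τ ≤ σ) :
    Real.log c • (1 : Matrix (Fin d) (Fin d) ℂ) + mlog τ ≤ mlog σ := by
  have hτ0 : IsStrictlyPositive τ := Matrix.isStrictlyPositive_iff_posDef.mpr hτ
  have hcτ : IsStrictlyPositive (c • τ) := hτ0.smul hc
  have key := CFC.log_le_log h hcτ
  rwa [CFC.log_smul' τ hc hτ0, Algebra.algebraMap_eq_smul_one] at key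

theorem trR_mpow_mul_mono {d : ℕ} {ρ σ τ : Matrix (Fin d) (Fin d) ℂ} (hρ : ρ.PosDef)
    (hτ : τ.PosDef) (α : ℝ) {c s : ℝ} (hc : 0 ≤ c) (hs : s ∈ Set.Icc (0 : ℝ) 1)
    (h : (σ - c • τ).PosSemidef) :
    c ^ s * trR (mpow ρ α * mpow τ s) ≤ trR (mpow ρ α * mpow σ s) := by
  have key := trR_mul_nonneg (mpow_posSemidef hρ α)
    (Matrix.le_iff.mp (smul_mpow_le_mpow hτ hc hs (Matrix.le_iff.mpr h)))
  rwa [mul_sub, trR_sub, Matrix.mul_smul, trR_smul, sub_nonneg] at key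

theorem Dumegaki_le_sub_log {d : ℕ} {ρ σ τ : Matrix (Fin d) (Fin d) ℂ}
    (hρ : ρ.PosDef ∧ ρ.trace = 1) (hτ : τ.PosDef) {c : ℝ} (hc : 0 < c)
    (h : (σ - c • τ).PosSemidef) :
    Dumegaki ρ σ ≤ Dumegaki ρ τ - Real.log c := by
  have key := trR_mul_nonneg hρ.1.posSemidef
    (Matrix.le_iff.mp (log_add_mlog_le_mlog hτ hc (Matrix.le_iff.mpr h)))
  have h1 : trR ρ = 1 := by simp [trR, hρ.2]
  have h2 : ρ * (mlog σ - (Real.log c • (1 : Matrix (Fin d) (Fin d) ℂ) + mlog τ)) =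
      ρ * (mlog ρ - mlog τ) - ρ * (mlog ρ - mlog σ) - Real.log c • ρ := by
    simp only [mul_sub, mul_add, Matrix.mul_smul, mul_one]
    abel
  rw [h2, trR_sub, trR_sub, trR_smul, h1] at key
  simp only [Dumegaki]
  linarith

end OperatorMonotone

theorem Dumegaki_eq_sum {d : ℕ} {ρ σ : Matrix (Fin d) (Fin d) ℂ} (hρ : ρ.PosDef)
    (hσ : σ.PosDef) {w : Fin d → Fin d → ℝ} {p q : Fin d → ℝ}
    (hw : ∀ f g : ℝ → ℝ, trR (cfc f ρ * cfc g σ) = ∑ i, ∑ j, w i j * (f (p i) * g (q j))) :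
    Dumegaki ρ σ = ∑ i, ∑ j, w i j * (p i * (Real.log (p i) - Real.log (q j))) := by
  have hcont (τ : Matrix (Fin d) (Fin d) ℂ) (f : ℝ → ℝ) : ContinuousOn f (spectrum ℝ τ) :=
    (Matrix.finite_real_spectrum (A := τ)).continuousOn f
  have hρs : IsSelfAdjoint ρ := hρ.isHermitian
  have hσs : IsSelfAdjoint σ := hσ.isHermitian
  have h1 : ρ * mlog ρ = cfc (fun x : ℝ => x * Real.log x) ρ * cfc (fun _ : ℝ => 1) σ := by
    rw [cfc_const_one ℝ σ, mul_one, cfc_mul (fun x => x) Real.log ρ (hcont _ _) (hcont _ _),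
      cfc_id' ℝ ρ, mlog]
  have h2 : ρ * mlog σ = cfc (fun x : ℝ => x) ρ * cfc Real.log σ := by
    rw [cfc_id' ℝ ρ, mlog]
  rw [Dumegaki, mul_sub, trR_sub, h1, h2, hw, hw, ← Finset.sum_sub_distrib]
  refine Finset.sum_congr rfl fun i _ => ?_
  rw [← Finset.sum_sub_distrib]
  exact Finset.sum_congr rfl fun j _ => by ring

/-- Positivity, Hölder bound and comparison with the Umegaki relative entropy for the
Petz quasi-entropy. -/
theorem petz_trace_bounds {d : ℕ} {ρ σ : Matrix (Fin d) (Fin d) ℂ}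
    (hρ : ρ.PosDef ∧ ρ.trace = 1) (hσ : σ.PosDef ∧ σ.trace = 1) {α : ℝ} (hα0 : 0 < α)
    (hα1 : α < 1) :
    0 < trR (mpow ρ α * mpow σ (1 - α)) ∧ trR (mpow ρ α * mpow σ (1 - α)) ≤ 1 ∧
      -((1 - α) * Dumegaki ρ σ) ≤ Real.log (trR (mpow ρ α * mpow σ (1 - α))) := by
  obtain ⟨w, p, q, hw0, hw1, hw2, hp, hq, hps, hqs, hw⟩ := exists_spectral_coupling hρ hσ
  have hT : trR (mpow ρ α * mpow σ (1 - α)) =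
      ∑ i, ∑ j, w i j * (p i ^ α * q j ^ (1 - α)) := hw _ _
  have hwp : ∑ i, ∑ j, w i j * p i = 1 := by
    simp_rw [← Finset.sum_mul, hw1, one_mul, hps]
  have hwq : ∑ i, ∑ j, w i j * q j = 1 := by
    rw [Finset.sum_comm]
    simp_rw [← Finset.sum_mul, hw2, one_mul, hqs]
  let wt : Fin d × Fin d → ℝ := fun x => w x.1 x.2 * p x.1
  let r : Fin d × Fin d → ℝ := fun x => (q x.2 / p x.1) ^ (1 - α)
  have hwt0 : ∀ x ∈ Finset.univ, 0 ≤ wt x := fun x _ => mul_nonneg (hw0 _ _) (hp _).le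
  have hwt1 : ∑ x, wt x = 1 := by rw [Fintype.sum_prod_type]; exact hwp
  have hr : ∀ x ∈ Finset.univ, r x ∈ Set.Ioi (0 : ℝ) :=
    fun x _ => Real.rpow_pos_of_pos (div_pos (hq _) (hp _)) _
  have hTr : trR (mpow ρ α * mpow σ (1 - α)) = ∑ x, wt x • r x := by
    rw [hT, Fintype.sum_prod_type]
    refine Finset.sum_congr rfl fun i _ => Finset.sum_congr rfl fun j _ => ?_
    have : p i ^ α = p i / p i ^ (1 - α) := by
      rw [eq_div_iff (Real.rpow_pos_of_pos (hp i) _).ne', ← Real.rpow_add (hp i)]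
      simp
    simp only [wt, r, smul_eq_mul]
    rw [Real.div_rpow (hq j).le (hp i).le, this]
    ring
  refine ⟨?_, ?_, ?_⟩
  · rw [hTr]
    exact (convex_Ioi (0 : ℝ)).sum_mem hwt0 hwt1 hr
  · calc trR (mpow ρ α * mpow σ (1 - α))
        ≤ ∑ i, ∑ j, (α * (w i j * p i) + (1 - α) * (w i j * q j)) := by
          rw [hT]
          refine Finset.sum_le_sum fun i _ => Finset.sum_le_sum fun j _ => ?_
          have := mul_le_mul_of_nonneg_left (Real.geom_mean_le_arith_mean2_weighted hα0.le
            (sub_pos.mpr hα1).le (hp i).le (hq j).le (by ring)) (hw0 i j)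
          linarith
      _ = 1 := by
          simp_rw [Finset.sum_add_distrib, ← Finset.mul_sum, hwp, hwq]
          ring
  · have := strictConcaveOn_log_Ioi.concaveOn.le_map_sum hwt0 hwt1 hr
    rw [← hTr] at this
    refine le_trans (le_of_eq ?_) this
    rw [Dumegaki_eq_sum hρ.1 hσ.1 hw, Fintype.sum_prod_type, Finset.mul_sum,
      ← Finset.sum_neg_distrib]
    refine Finset.sum_congr rfl fun i _ => ?_
    rw [Finset.mul_sum, ← Finset.sum_neg_distrib]
    refine Finset.sum_congr rfl fun j _ => ?_
    simp only [wt, r, smul_eq_mul]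
    rw [Real.log_rpow (div_pos (hq j) (hp i)), Real.log_div (hq j).ne' (hp i).ne']
    ring

theorem Dumegaki_nonneg {d : ℕ} {ρ σ : Matrix (Fin d) (Fin d) ℂ}
    (hρ : ρ.PosDef ∧ ρ.trace = 1) (hσ : σ.PosDef ∧ σ.trace = 1) : 0 ≤ Dumegaki ρ σ := by
  obtain ⟨h0, h1, h2⟩ := petz_trace_bounds hρ hσ (α := 1 / 2) (by norm_num) (by norm_num)
  have := Real.log_nonpos h0.le h1
  linarith

/-- The objective function minimized in `renyiInfoFull`. -/
noncomputable def renyiObjective {d n : ℕ} (α : ℝ) (W : Fin n → Matrix (Fin d) (Fin d) ℂ)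
    (P : Fin n → ℝ) (σ : Dens d) : ℝ :=
  if α = 1 then ∑ i, P i * Dumegaki (W i) σ.1
  else (1 / (α - 1)) * Real.log (∑ i, P i * trR (mpow (W i) α * mpow σ.1 (1 - α)))

theorem renyiInfoFull_eq_iInf {d n : ℕ} (α : ℝ) (W : Fin n → Matrix (Fin d) (Fin d) ℂ)
    (P : Fin n → ℝ) : renyiInfoFull α W P = ⨅ σ : Dens d, renyiObjective α W P σ := by
  unfold renyiInfoFull renyiObjective
  split_ifs <;> rfl

section Objective

variable {d n : ℕ} {W : Fin n → Matrix (Fin d) (Fin d) ℂ}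

theorem petz_sum_mem_Ioc (hW : ∀ i, (W i).PosDef ∧ (W i).trace = 1) {P : Fin n → ℝ}
    (hP0 : ∀ i, 0 ≤ P i) (hP1 : ∑ i, P i = 1) {α : ℝ} (hα0 : 0 < α) (hα1 : α < 1)
    (σ : Dens d) :
    ∑ i, P i * trR (mpow (W i) α * mpow σ.1 (1 - α)) ∈ Set.Ioc (0 : ℝ) 1 :=
  (convex_Ioc (0 : ℝ) 1).sum_mem (fun i _ => hP0 i) hP1 fun i _ =>
    ⟨(petz_trace_bounds (hW i) σ.2 hα0 hα1).1, (petz_trace_bounds (hW i) σ.2 hα0 hα1).2.1⟩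

theorem renyiObjective_nonneg (hW : ∀ i, (W i).PosDef ∧ (W i).trace = 1) {P : Fin n → ℝ}
    (hP0 : ∀ i, 0 ≤ P i) (hP1 : ∑ i, P i = 1) {α : ℝ} (hα : α ∈ Set.Ioc (0 : ℝ) 1)
    (σ : Dens d) : 0 ≤ renyiObjective α W P σ := by
  unfold renyiObjective
  split_ifs with h
  · exact Finset.sum_nonneg fun i _ => mul_nonneg (hP0 i) (Dumegaki_nonneg (hW i) σ.2)
  · have hα1 : α < 1 := lt_of_le_of_ne hα.2 h
    obtain ⟨h0, h1⟩ := petz_sum_mem_Ioc hW hP0 hP1 hα.1 hα1 σ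
    exact mul_nonneg_of_nonpos_of_nonpos
      (div_nonpos_of_nonneg_of_nonpos zero_le_one (by linarith)) (Real.log_nonpos h0.le h1)

theorem renyiObjective_le_one (hW : ∀ i, (W i).PosDef ∧ (W i).trace = 1) {P : Fin n → ℝ}
    (hP0 : ∀ i, 0 ≤ P i) (hP1 : ∑ i, P i = 1) {α : ℝ} (hα : α ∈ Set.Ioc (0 : ℝ) 1)
    (σ : Dens d) : renyiObjective α W P σ ≤ renyiObjective 1 W P σ := by
  by_cases h : α = 1
  · rw [h]
  have hα1 : α < 1 := lt_of_le_of_ne hα.2 h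
  have hs : 0 < 1 - α := sub_pos.mpr hα1
  rw [renyiObjective, renyiObjective, if_neg h, if_pos rfl]
  have hjensen := strictConcaveOn_log_Ioi.concaveOn.le_map_sum
    (t := Finset.univ) (w := P) (p := fun i => trR (mpow (W i) α * mpow σ.1 (1 - α)))
    (fun i _ => hP0 i) hP1 fun i _ => (petz_trace_bounds (hW i) σ.2 hα.1 hα1).1
  simp only [smul_eq_mul] at hjensen
  have hle : -((1 - α) * ∑ i, P i * Dumegaki (W i) σ.1) ≤
      ∑ i, P i * Real.log (trR (mpow (W i) α * mpow σ.1 (1 - α))) := by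
    rw [Finset.mul_sum, ← Finset.sum_neg_distrib]
    refine Finset.sum_le_sum fun i _ => ?_
    have := mul_le_mul_of_nonneg_left (petz_trace_bounds (hW i) σ.2 hα.1 hα1).2.2 (hP0 i)
    linarith
  have hneg : α - 1 = -(1 - α) := by ring
  rw [hneg, one_div, inv_neg, neg_mul, neg_le, ← div_eq_inv_mul, le_div_iff₀ hs]
  linarith

/-- Concatenation bound: a mixture of priors costs at most the averaged objective values plus
the binary entropy of the mixing weight. -/
theorem exists_renyiObjective_mix_le (hW : ∀ i, (W i).PosDef ∧ (W i).trace = 1)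
    {R S : Fin n → ℝ} (hR0 : ∀ i, 0 ≤ R i) (hR1 : ∑ i, R i = 1) (hS0 : ∀ i, 0 ≤ S i)
    (hS1 : ∑ i, S i = 1) {α : ℝ} (hα : α ∈ Set.Ioc (0 : ℝ) 1) {δ : ℝ}
    (hδ : δ ∈ Set.Icc (0 : ℝ) 1) (σ τ : Dens d) :
    ∃ ω : Dens d, renyiObjective α W (fun i => (1 - δ) * R i + δ * S i) ω ≤
      bent δ + (1 - δ) * renyiObjective α W R σ + δ * renyiObjective α W S τ := by
  rcases hδ.1.eq_or_lt with rfl | hδ0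
  · exact ⟨σ, by simp [bent]⟩
  rcases hδ.2.eq_or_lt with rfl | hδ1
  · exact ⟨τ, by simp [bent]⟩
  have hδ' : 0 < 1 - δ := sub_pos.mpr hδ1
  have hσ' : ((1 - δ) • σ.1).PosDef := σ.2.1.smul hδ'
  have hτ' : (δ • τ.1).PosDef := τ.2.1.smul hδ0
  refine ⟨⟨(1 - δ) • σ.1 + δ • τ.1, hσ'.add hτ', ?_⟩, ?_⟩
  · rw [Matrix.trace_add, Matrix.trace_smul, Matrix.trace_smul, σ.2.2, τ.2.2, ← add_smul]
    simp
  set ω : Matrix (Fin d) (Fin d) ℂ := (1 - δ) • σ.1 + δ • τ.1 with hω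
  have hωσ : (ω - (1 - δ) • σ.1).PosSemidef := by
    rw [hω, add_sub_cancel_left]; exact hτ'.posSemidef
  have hωτ : (ω - δ • τ.1).PosSemidef := by
    rw [hω, add_sub_cancel_right]; exact hσ'.posSemidef
  unfold renyiObjective
  split_ifs with h
  · have hR : ∑ i, R i * Dumegaki (W i) ω ≤
        ∑ i, R i * Dumegaki (W i) σ.1 - Real.log (1 - δ) := by
      calc _ ≤ ∑ i, R i * (Dumegaki (W i) σ.1 - Real.log (1 - δ)) :=
            Finset.sum_le_sum fun i _ => mul_le_mul_of_nonneg_left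
              (Dumegaki_le_sub_log (hW i) σ.2.1 hδ' hωσ) (hR0 i)
        _ = _ := by simp_rw [mul_sub, Finset.sum_sub_distrib, ← Finset.sum_mul, hR1, one_mul]
    have hS : ∑ i, S i * Dumegaki (W i) ω ≤
        ∑ i, S i * Dumegaki (W i) τ.1 - Real.log δ := by
      calc _ ≤ ∑ i, S i * (Dumegaki (W i) τ.1 - Real.log δ) :=
            Finset.sum_le_sum fun i _ => mul_le_mul_of_nonneg_left
              (Dumegaki_le_sub_log (hW i) τ.2.1 hδ0 hωτ) (hS0 i)
        _ = _ := by simp_rw [mul_sub, Finset.sum_sub_distrib, ← Finset.sum_mul, hS1, one_mul]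
    simp_rw [add_mul, Finset.sum_add_distrib, mul_assoc, ← Finset.mul_sum]
    have hR' := mul_le_mul_of_nonneg_left hR hδ'.le
    have hS' := mul_le_mul_of_nonneg_left hS hδ0.le
    unfold bent
    linarith
  · have hα1 : α < 1 := lt_of_le_of_ne hα.2 h
    have hs : 0 < 1 - α := sub_pos.mpr hα1
    have hsI : 1 - α ∈ Set.Icc (0 : ℝ) 1 := ⟨hs.le, by linarith [hα.1]⟩
    obtain ⟨hRpos, -⟩ := petz_sum_mem_Ioc hW hR0 hR1 hα.1 hα1 σ
    obtain ⟨hSpos, -⟩ := petz_sum_mem_Ioc hW hS0 hS1 hα.1 hα1 τ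
    have hR : (1 - δ) ^ (1 - α) * ∑ i, R i * trR (mpow (W i) α * mpow σ.1 (1 - α)) ≤
        ∑ i, R i * trR (mpow (W i) α * mpow ω (1 - α)) := by
      rw [Finset.mul_sum]
      refine Finset.sum_le_sum fun i _ => ?_
      rw [mul_left_comm]
      exact mul_le_mul_of_nonneg_left
        (trR_mpow_mul_mono (hW i).1 σ.2.1 α hδ'.le hsI hωσ) (hR0 i)
    have hS : δ ^ (1 - α) * ∑ i, S i * trR (mpow (W i) α * mpow τ.1 (1 - α)) ≤
        ∑ i, S i * trR (mpow (W i) α * mpow ω (1 - α)) := by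
      rw [Finset.mul_sum]
      refine Finset.sum_le_sum fun i _ => ?_
      rw [mul_left_comm]
      exact mul_le_mul_of_nonneg_left
        (trR_mpow_mul_mono (hW i).1 τ.2.1 α hδ0.le hsI hωτ) (hS0 i)
    simp_rw [add_mul, Finset.sum_add_distrib, mul_assoc, ← Finset.mul_sum]
    set x := ∑ i, R i * trR (mpow (W i) α * mpow σ.1 (1 - α))
    set y := ∑ i, S i * trR (mpow (W i) α * mpow τ.1 (1 - α))
    have hδ's : 0 < (1 - δ) ^ (1 - α) := Real.rpow_pos_of_pos hδ' _
    have hδs : 0 < δ ^ (1 - α) := Real.rpow_pos_of_pos hδ0 _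
    have hjensen := strictConcaveOn_log_Ioi.concaveOn.2 (mul_pos hδ's hRpos)
      (mul_pos hδs hSpos) hδ'.le hδ0.le (by ring)
    simp only [smul_eq_mul] at hjensen
    rw [Real.log_mul hδ's.ne' hRpos.ne', Real.log_mul hδs.ne' hSpos.ne',
      Real.log_rpow hδ', Real.log_rpow hδ0] at hjensen
    have hlog := hjensen.trans (Real.log_le_log
      (add_pos (mul_pos hδ' (mul_pos hδ's hRpos)) (mul_pos hδ0 (mul_pos hδs hSpos)))
      (add_le_add (mul_le_mul_of_nonneg_left hR hδ'.le) (mul_le_mul_of_nonneg_left hS hδ0.le)))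
    have hneg : 1 / (α - 1) = -(1 / (1 - α)) := by
      rw [← neg_sub 1 α, one_div, one_div, inv_neg]
    have hscaled := mul_le_mul_of_nonneg_left hlog (one_div_nonneg.mpr hs.le)
    have hcancel : (1 / (1 - α)) * (1 - α) = 1 := by field_simp
    rw [hneg]
    unfold bent
    linear_combination hscaled - ((1 - δ) * Real.log (1 - δ) + δ * Real.log δ) * hcancel

theorem log_mix_exp_mul_le {δ : ℝ} (hδ : δ ∈ Set.Icc (0 : ℝ) 1) {s : ℝ}
    (hs : s ∈ Set.Icc (0 : ℝ) 1) (C : ℝ) :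
    Real.log (1 - δ + δ * Real.exp (s * C)) ≤ s * Real.log (1 - δ + δ * Real.exp C) := by
  have hpos (x : ℝ) : 0 < 1 - δ + δ * Real.exp x := by
    have := (convex_Ioi (0 : ℝ)) (Set.mem_Ioi.mpr one_pos) (Set.mem_Ioi.mpr (Real.exp_pos x))
      (sub_nonneg.mpr hδ.2) hδ.1 (by ring)
    simpa using this
  have := (Real.concaveOn_rpow hs.1 hs.2).2 (Set.mem_Ici.mpr zero_le_one)
    (Set.mem_Ici.mpr (Real.exp_pos C).le) (sub_nonneg.mpr hδ.2) hδ.1 (by ring)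
  simp only [smul_eq_mul, mul_one, Real.one_rpow, ← Real.exp_mul, mul_comm C s] at this
  exact (Real.log_le_log (hpos _) this).trans_eq (Real.log_rpow (hpos C) s)

theorem le_renyiObjective_mix (hW : ∀ i, (W i).PosDef ∧ (W i).trace = 1)
    {R S : Fin n → ℝ} (hR0 : ∀ i, 0 ≤ R i) (hR1 : ∑ i, R i = 1) (hS0 : ∀ i, 0 ≤ S i)
    (hS1 : ∑ i, S i = 1) {α : ℝ} (hα : α ∈ Set.Ioc (0 : ℝ) 1) {δ : ℝ}
    (hδ : δ ∈ Set.Icc (0 : ℝ) 1) (σ : Dens d) {a C : ℝ} (ha0 : 0 ≤ a) (haC : a ≤ C)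
    (ha : a ≤ renyiObjective α W R σ) :
    (1 - δ) * a - Real.log (1 - δ + δ * Real.exp C) ≤
      renyiObjective α W (fun i => (1 - δ) * R i + δ * S i) σ := by
  have hδ' : 0 ≤ 1 - δ := sub_nonneg.mpr hδ.2
  by_cases h : α = 1
  · subst h
    have hS := renyiObjective_nonneg hW hS0 hS1 hα σ
    have hlog : 0 ≤ Real.log (1 - δ + δ * Real.exp C) := by
      refine Real.log_nonneg ?_
      have := mul_le_mul_of_nonneg_left (Real.one_le_exp (ha0.trans haC)) hδ.1
      linarith
    have hmix : renyiObjective 1 W (fun i => (1 - δ) * R i + δ * S i) σ =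
        (1 - δ) * renyiObjective 1 W R σ + δ * renyiObjective 1 W S σ := by
      simp_rw [renyiObjective, if_pos, add_mul, Finset.sum_add_distrib, mul_assoc,
        ← Finset.mul_sum]
    rw [hmix]
    have := mul_le_mul_of_nonneg_left ha hδ'
    have := mul_nonneg hδ.1 hS
    linarith
  · have hα1 : α < 1 := lt_of_le_of_ne hα.2 h
    have hs : 0 < 1 - α := sub_pos.mpr hα1
    have hsI : 1 - α ∈ Set.Icc (0 : ℝ) 1 := ⟨hs.le, by linarith [hα.1]⟩
    have hneg : 1 / (α - 1) = -(1 / (1 - α)) := by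
      rw [← neg_sub 1 α, one_div, one_div, inv_neg]
    obtain ⟨hRpos, -⟩ := petz_sum_mem_Ioc hW hR0 hR1 hα.1 hα1 σ
    obtain ⟨hSpos, hSle⟩ := petz_sum_mem_Ioc hW hS0 hS1 hα.1 hα1 σ
    simp_rw [renyiObjective, if_neg h, hneg] at ha ⊢
    simp_rw [add_mul, Finset.sum_add_distrib, mul_assoc, ← Finset.mul_sum]
    set x := ∑ i, R i * trR (mpow (W i) α * mpow σ.1 (1 - α))
    set y := ∑ i, S i * trR (mpow (W i) α * mpow σ.1 (1 - α))
    have hlogx : Real.log x ≤ -((1 - α) * a) := by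
      rw [neg_mul, one_div_mul_eq_div, le_neg, div_le_iff₀ hs] at ha
      linarith
    have hx : x ≤ Real.exp (-((1 - α) * a)) := (Real.log_le_iff_le_exp hRpos).mp hlogx
    have hpos : 0 < (1 - δ) * x + δ * y := by
      have := (convex_Ioi (0 : ℝ)) hRpos hSpos hδ' hδ.1 (by ring)
      simpa using this
    have hexp : Real.exp (-((1 - α) * a)) * Real.exp ((1 - α) * a) = 1 := by
      rw [← Real.exp_add]; simp
    have hle : (1 - δ) * x + δ * y ≤
        Real.exp (-((1 - α) * a)) * (1 - δ + δ * Real.exp ((1 - α) * C)) := by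
      have h1 := mul_le_mul_of_nonneg_left hx hδ'
      have h2 := mul_le_mul_of_nonneg_left hSle hδ.1
      have h3 := mul_le_mul_of_nonneg_left (Real.exp_le_exp.mpr
        (mul_le_mul_of_nonneg_left haC hs.le))
        (mul_nonneg hδ.1 (Real.exp_pos (-((1 - α) * a))).le)
      linear_combination h1 + h2 + h3 - δ * hexp
    have hpos' : 0 < 1 - δ + δ * Real.exp ((1 - α) * C) :=
      (mul_pos_iff_of_pos_left (Real.exp_pos _)).mp (hpos.trans_le hle)
    have hlog := Real.log_le_log hpos hle
    rw [Real.log_mul (Real.exp_pos _).ne' hpos'.ne', Real.log_exp] at hlog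
    have hbound := hlog.trans (add_le_add_right (log_mix_exp_mul_le hδ hsI C) _)
    have hδa := mul_nonneg hδ.1 ha0
    have hscaled := mul_le_mul_of_nonneg_left hbound (one_div_nonneg.mpr hs.le)
    have hcancel : (1 / (1 - α)) * (1 - α) = 1 := by field_simp
    linear_combination hscaled + hδa +
      (Real.log (1 - δ + δ * Real.exp C) - a) * hcancel

end Objective

theorem exists_common_mixture {n : ℕ} {P₁ P₂ : Fin n → ℝ} (hP₁0 : ∀ i, 0 ≤ P₁ i)
    (hP₁1 : ∑ i, P₁ i = 1) (hP₂0 : ∀ i, 0 ≤ P₂ i) (hP₂1 : ∑ i, P₂ i = 1) {δ : ℝ}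
    (hδ : δ = (1 / 2) * ∑ i, |P₁ i - P₂ i|) :
    δ ∈ Set.Icc (0 : ℝ) 1 ∧ ∃ R S₁ S₂ : Fin n → ℝ,
      ((∀ i, 0 ≤ R i) ∧ ∑ i, R i = 1) ∧ ((∀ i, 0 ≤ S₁ i) ∧ ∑ i, S₁ i = 1) ∧
      ((∀ i, 0 ≤ S₂ i) ∧ ∑ i, S₂ i = 1) ∧
      P₁ = (fun i => (1 - δ) * R i + δ * S₁ i) ∧ P₂ = (fun i => (1 - δ) * R i + δ * S₂ i) := by
  have hmin0 (i : Fin n) : 0 ≤ min (P₁ i) (P₂ i) := le_min (hP₁0 i) (hP₂0 i)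
  have hminsum : ∑ i, min (P₁ i) (P₂ i) = 1 - δ := by
    have hmin (i : Fin n) : min (P₁ i) (P₂ i) = (1 / 2) * (P₁ i + P₂ i - |P₁ i - P₂ i|) := by
      rcases le_total (P₁ i) (P₂ i) with h | h
      · rw [min_eq_left h, abs_of_nonpos (sub_nonpos.mpr h)]
        ring
      · rw [min_eq_right h, abs_of_nonneg (sub_nonneg.mpr h)]
        ring
    simp_rw [hmin, ← Finset.mul_sum, Finset.sum_sub_distrib, Finset.sum_add_distrib, hP₁1,
      hP₂1, hδ]
    ring
  have hδ0 : 0 ≤ δ := hδ ▸ mul_nonneg (by norm_num) (Finset.sum_nonneg fun i _ => abs_nonneg _)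
  have hδ1 : 0 ≤ 1 - δ := hminsum ▸ Finset.sum_nonneg fun i _ => hmin0 i
  refine ⟨⟨hδ0, sub_nonneg.mp hδ1⟩, ?_⟩
  rcases hδ0.eq_or_lt with h0 | hpos
  · have habs : ∑ i, |P₁ i - P₂ i| = 0 := by linarith
    have heq : P₂ = P₁ := funext fun i => (sub_eq_zero.mp (abs_eq_zero.mp
      ((Finset.sum_eq_zero_iff_of_nonneg fun i _ => abs_nonneg _).mp habs i
        (Finset.mem_univ i)))).symm
    subst heq
    refine ⟨P₂, P₂, P₂, ⟨hP₁0, hP₁1⟩, ⟨hP₁0, hP₁1⟩, ⟨hP₁0, hP₁1⟩, ?_, ?_⟩ <;>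
    · ext i
      ring
  rcases hδ1.eq_or_lt with h1 | hlt
  · have hδeq : δ = 1 := by linarith
    refine ⟨P₁, P₁, P₂, ⟨hP₁0, hP₁1⟩, ⟨hP₁0, hP₁1⟩, ⟨hP₂0, hP₂1⟩, ?_, ?_⟩ <;>
    · ext i
      simp [hδeq]
  · refine ⟨fun i => min (P₁ i) (P₂ i) / (1 - δ), fun i => (P₁ i - min (P₁ i) (P₂ i)) / δ,
      fun i => (P₂ i - min (P₁ i) (P₂ i)) / δ,
      ⟨fun i => div_nonneg (hmin0 i) hlt.le, ?_⟩,
      ⟨fun i => div_nonneg (sub_nonneg.mpr (min_le_left _ _)) hpos.le, ?_⟩,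
      ⟨fun i => div_nonneg (sub_nonneg.mpr (min_le_right _ _)) hpos.le, ?_⟩, ?_, ?_⟩
    · rw [← Finset.sum_div, hminsum, div_self hlt.ne']
    · rw [← Finset.sum_div, Finset.sum_sub_distrib, hminsum, hP₁1, sub_sub_cancel,
        div_self hpos.ne']
    · rw [← Finset.sum_div, Finset.sum_sub_distrib, hminsum, hP₂1, sub_sub_cancel,
        div_self hpos.ne']
    · ext i
      rw [mul_div_cancel₀ _ hlt.ne', mul_div_cancel₀ _ hpos.ne', add_sub_cancel]
    · ext i
      rw [mul_div_cancel₀ _ hlt.ne', mul_div_cancel₀ _ hpos.ne', add_sub_cancel]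

section Information

variable {d n : ℕ} {W : Fin n → Matrix (Fin d) (Fin d) ℂ}

theorem bddBelow_renyiObjective (hW : ∀ i, (W i).PosDef ∧ (W i).trace = 1) {P : Fin n → ℝ}
    (hP0 : ∀ i, 0 ≤ P i) (hP1 : ∑ i, P i = 1) {α : ℝ} (hα : α ∈ Set.Ioc (0 : ℝ) 1) :
    BddBelow (Set.range (renyiObjective α W P)) :=
  ⟨0, Set.forall_mem_range.mpr (renyiObjective_nonneg hW hP0 hP1 hα)⟩

theorem renyiInfoFull_le_one [Nonempty (Dens d)] (hW : ∀ i, (W i).PosDef ∧ (W i).trace = 1)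
    {P : Fin n → ℝ} (hP0 : ∀ i, 0 ≤ P i) (hP1 : ∑ i, P i = 1) {α : ℝ}
    (hα : α ∈ Set.Ioc (0 : ℝ) 1) : renyiInfoFull α W P ≤ renyiInfoFull 1 W P := by
  rw [renyiInfoFull_eq_iInf, renyiInfoFull_eq_iInf]
  exact ciInf_mono (bddBelow_renyiObjective hW hP0 hP1 hα)
    (renyiObjective_le_one hW hP0 hP1 hα)

theorem renyiInfoFull_mix_le [Nonempty (Dens d)] (hW : ∀ i, (W i).PosDef ∧ (W i).trace = 1)
    {R S : Fin n → ℝ} (hR0 : ∀ i, 0 ≤ R i) (hR1 : ∑ i, R i = 1) (hS0 : ∀ i, 0 ≤ S i)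
    (hS1 : ∑ i, S i = 1) {α : ℝ} (hα : α ∈ Set.Ioc (0 : ℝ) 1) {δ : ℝ}
    (hδ : δ ∈ Set.Icc (0 : ℝ) 1) :
    renyiInfoFull α W (fun i => (1 - δ) * R i + δ * S i) ≤
      bent δ + (1 - δ) * renyiInfoFull α W R + δ * renyiInfoFull α W S := by
  have hδ' : 0 ≤ 1 - δ := sub_nonneg.mpr hδ.2
  have hmix0 (i : Fin n) : 0 ≤ (1 - δ) * R i + δ * S i :=
    add_nonneg (mul_nonneg hδ' (hR0 i)) (mul_nonneg hδ.1 (hS0 i))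
  have hmix1 : ∑ i, ((1 - δ) * R i + δ * S i) = 1 := by
    rw [Finset.sum_add_distrib, ← Finset.mul_sum, ← Finset.mul_sum, hR1, hS1]
    ring
  simp_rw [renyiInfoFull_eq_iInf]
  refine le_of_forall_pos_le_add fun ε hε => ?_
  obtain ⟨σ, hσ⟩ := exists_lt_of_ciInf_lt
    (lt_add_of_pos_right (⨅ σ : Dens d, renyiObjective α W R σ) hε)
  obtain ⟨τ, hτ⟩ := exists_lt_of_ciInf_lt
    (lt_add_of_pos_right (⨅ σ : Dens d, renyiObjective α W S σ) hε)
  obtain ⟨ω, hω⟩ := exists_renyiObjective_mix_le hW hR0 hR1 hS0 hS1 hα hδ σ τ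
  have := ciInf_le (bddBelow_renyiObjective hW hmix0 hmix1 hα) ω
  have := mul_le_mul_of_nonneg_left hσ.le hδ'
  have := mul_le_mul_of_nonneg_left hτ.le hδ.1
  linarith

theorem renyiInfoFull_mix_sub_mix_le [Nonempty (Dens d)]
    (hW : ∀ i, (W i).PosDef ∧ (W i).trace = 1)
    {R S T : Fin n → ℝ} (hR0 : ∀ i, 0 ≤ R i) (hR1 : ∑ i, R i = 1) (hS0 : ∀ i, 0 ≤ S i)
    (hS1 : ∑ i, S i = 1) (hT0 : ∀ i, 0 ≤ T i) (hT1 : ∑ i, T i = 1) {α : ℝ}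
    (hα : α ∈ Set.Ioc (0 : ℝ) 1) {δ : ℝ} (hδ : δ ∈ Set.Icc (0 : ℝ) 1) {C : ℝ}
    (hRC : renyiInfoFull α W R ≤ C) (hSC : renyiInfoFull α W S ≤ C) :
    renyiInfoFull α W (fun i => (1 - δ) * R i + δ * S i) -
        renyiInfoFull α W (fun i => (1 - δ) * R i + δ * T i) ≤
      δ * C + bent δ + Real.log (1 - δ + δ * Real.exp C) := by
  have hupper := renyiInfoFull_mix_le hW hR0 hR1 hS0 hS1 hα hδ
  have hlower : (1 - δ) * renyiInfoFull α W R - Real.log (1 - δ + δ * Real.exp C) ≤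
      renyiInfoFull α W (fun i => (1 - δ) * R i + δ * T i) := by
    rw [renyiInfoFull_eq_iInf α W fun i => (1 - δ) * R i + δ * T i]
    refine le_ciInf fun σ => le_renyiObjective_mix hW hR0 hR1 hT0 hT1 hα hδ σ ?_ hRC ?_
    · rw [renyiInfoFull_eq_iInf]
      exact le_ciInf (renyiObjective_nonneg hW hR0 hR1 hα)
    · rw [renyiInfoFull_eq_iInf]
      exact ciInf_le (bddBelow_renyiObjective hW hR0 hR1 hα) σ
  have := mul_le_mul_of_nonneg_left hSC hδ.1
  linarith

theorem bddAbove_renyiInfoFull_one (σ : Dens d) (hW : ∀ i, (W i).PosDef ∧ (W i).trace = 1) :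
    BddAbove (Set.range fun Q : {Q : Fin n → ℝ // (∀ i, 0 ≤ Q i) ∧ ∑ i, Q i = 1} =>
      renyiInfoFull 1 W Q.1) := by
  refine ⟨∑ i, Dumegaki (W i) σ.1, Set.forall_mem_range.mpr fun Q => ?_⟩
  rw [renyiInfoFull_eq_iInf]
  refine (ciInf_le (bddBelow_renyiObjective hW Q.2.1 Q.2.2
    (Set.right_mem_Ioc.mpr one_pos)) σ).trans ?_
  rw [renyiObjective, if_pos rfl]
  refine Finset.sum_le_sum fun i _ => ?_
  refine mul_le_of_le_one_left (Dumegaki_nonneg (hW i) σ.2) ?_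
  exact (Finset.single_le_sum (fun j _ => Q.2.1 j) (Finset.mem_univ i)).trans_eq Q.2.2

end Information

/-- uniform continuity of the Rényi information in the prior. -/
theorem renyiInfo_uniform_continuity_in_prior {d n : ℕ} (hd : 0 < d) (hn : 0 < n)
    (W : Fin n → Matrix (Fin d) (Fin d) ℂ)
    (hW : ∀ i, (W i).PosDef ∧ (W i).trace = 1)
    (C : ℝ)
    (hC : C = ⨆ Q : {Q : Fin n → ℝ // (∀ i, 0 ≤ Q i) ∧ ∑ i, Q i = 1},
      renyiInfoFull 1 W Q.1) :
    BddAbove (Set.range fun Q : {Q : Fin n → ℝ // (∀ i, 0 ≤ Q i) ∧ ∑ i, Q i = 1} =>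
      renyiInfoFull 1 W Q.1) ∧
    ∀ P₁ P₂ : Fin n → ℝ,
      (∀ i, 0 ≤ P₁ i) → ∑ i, P₁ i = 1 →
      (∀ i, 0 ≤ P₂ i) → ∑ i, P₂ i = 1 →
      ∀ α ∈ Set.Ioc (0 : ℝ) 1,
        ∀ δ : ℝ, δ = (1 / 2) * ∑ i, |P₁ i - P₂ i| →
          |renyiInfoFull α W P₂ - renyiInfoFull α W P₁| ≤
            δ * C + bent δ + Real.log (1 - δ + δ * Real.exp C) := by
  have hne : Nonempty (Dens d) := ⟨⟨W ⟨0, hn⟩, hW _⟩⟩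
  have hbdd := bddAbove_renyiInfoFull_one hne.some hW
  refine ⟨hbdd, fun P₁ P₂ hP₁0 hP₁1 hP₂0 hP₂1 α hα δ hδ => ?_⟩
  obtain ⟨hδI, R, S₁, S₂, ⟨hR0, hR1⟩, ⟨hS₁0, hS₁1⟩, ⟨hS₂0, hS₂1⟩, rfl, rfl⟩ :=
    exists_common_mixture hP₁0 hP₁1 hP₂0 hP₂1 hδ
  have hle (Q : Fin n → ℝ) (hQ0 : ∀ i, 0 ≤ Q i) (hQ1 : ∑ i, Q i = 1) :
      renyiInfoFull α W Q ≤ C := by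
    rw [hC]
    exact (renyiInfoFull_le_one hW hQ0 hQ1 hα).trans (le_ciSup hbdd ⟨Q, hQ0, hQ1⟩)
  exact abs_sub_le_iff.mpr
    ⟨renyiInfoFull_mix_sub_mix_le hW hR0 hR1 hS₂0 hS₂1 hS₁0 hS₁1 hα hδI
      (hle R hR0 hR1) (hle S₂ hS₂0 hS₂1),
    renyiInfoFull_mix_sub_mix_le hW hR0 hR1 hS₁0 hS₁1 hS₂0 hS₂1 hα hδI
      (hle R hR0 hR1) (hle S₁ hS₁0 hS₁1)⟩
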